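/- arXiv:2211.12940 — 6 statements merged into one kernel-verified Lean document; each statement's English description precedes it below -/
import Mathlib

section
/- Let Z be a real reflexive Banach space, V a real Banach space, and j : Z → V a continuous dense embedding. Let R : Z → [0,∞] be proper, convex, lower semicontinuous and positively 1-homogeneous, let G : Z → ℝ be convex and Fréchet differentiable with derivative DG, let ρ > 0 and z₀ ∈ Z, and suppose z* minimizes z ↦ G(z) + R(z − z₀) over the set {z ∈ Z : ‖j(z − z₀)‖_V ≤ ρ}. Then there exists η ∈ V* such that, writing b := ‖j(z* − z₀)‖_V and d := dist_{V*}(−DG(z*), ∂R(0)), one has: (i) ‖η‖_{V*}·(b − ρ) = 0; (ii) ρ·d = ⟨η, j(z* − z₀)⟩ = ρ·‖η‖_{V*} = ‖η‖_{V*}·b; (iii) R(z* − z₀) + ρ·d = ⟨−DG(z*), z* − z₀⟩; (iv) R(z* − z₀) + b·d = ⟨−DG(z*), z* − z₀⟩; and (v) R(v) ≥ −⟨j*η + DG(z*), v⟩ for every v ∈ Z. In particular d < ∞. -/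
open Filter
open scoped ENNReal

noncomputable section

/-- The subdifferential of an `[0,∞]`-valued convex function `f` on a normed space `Z`
at a point `v`: the set of `ξ ∈ Z*` such that `f w ≥ f v + ⟨ξ, w - v⟩` for all `w`,
the inequality being understood in the extended reals. -/
def Subdiff {Z : Type*} [NormedAddCommGroup Z] [NormedSpace ℝ Z]
    (f : Z → ℝ≥0∞) (v : Z) : Set (Z →L[ℝ] ℝ) :=
  {ξ | ∀ w : Z, (f v : EReal) + ((ξ (w - v) : ℝ) : EReal) ≤ (f w : EReal)}

/-- Given a continuous dense embedding `j : Z → V`, the distance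
`dist_{V*}(ζ, A) = inf { ‖η‖_{V*} : η ∈ V*, ζ - j*η ∈ A } ∈ [0,∞]`,
with the convention `inf ∅ = ∞`. Here `j*η = η ∘ j`. -/
def DistVStar {Z V : Type*} [NormedAddCommGroup Z] [NormedSpace ℝ Z]
    [NormedAddCommGroup V] [NormedSpace ℝ V] (j : Z →L[ℝ] V)
    (ζ : Z →L[ℝ] ℝ) (A : Set (Z →L[ℝ] ℝ)) : ℝ≥0∞ :=
  ⨅ η ∈ {η : V →L[ℝ] ℝ | ζ - η.comp j ∈ A}, (‖η‖₊ : ℝ≥0∞)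

/-- Convexity of an `[0,∞]`-valued function. -/
def ConvexOnENN {Z : Type*} [NormedAddCommGroup Z] [NormedSpace ℝ Z]
    (f : Z → ℝ≥0∞) : Prop :=
  ∀ x y : Z, ∀ a b : ℝ, 0 ≤ a → 0 ≤ b → a + b = 1 →
    f (a • x + b • y) ≤ ENNReal.ofReal a * f x + ENNReal.ofReal b * f y

/-- Positive 1-homogeneity of an `[0,∞]`-valued function: `f 0 = 0` and
`f (λ • u) = λ * f u` for all `λ > 0`. -/
def PosOneHom {Z : Type*} [NormedAddCommGroup Z] [NormedSpace ℝ Z]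
    (f : Z → ℝ≥0∞) : Prop :=
  f 0 = 0 ∧ ∀ c : ℝ, 0 < c → ∀ u : Z, f (c • u) = ENNReal.ofReal c * f u

theorem exists_dual_le_of_sublinear {Z V : Type*} [NormedAddCommGroup Z] [NormedSpace ℝ Z]
    [NormedAddCommGroup V] [NormedSpace ℝ V] (j : Z →L[ℝ] V) (K : Set Z) (φ : Z → ℝ) (c : ℝ)
    (hc : 0 ≤ c) (h0 : (0 : Z) ∈ K) (hφ0 : φ 0 = 0)
    (hadd : ∀ x ∈ K, ∀ y ∈ K, x + y ∈ K ∧ φ (x + y) ≤ φ x + φ y)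
    (hsmul : ∀ t : ℝ, 0 < t → ∀ x ∈ K, t • x ∈ K ∧ φ (t • x) = t * φ x)
    (hbound : ∀ w ∈ K, 0 ≤ φ w + c * ‖j w‖) :
    ∃ η : V →L[ℝ] ℝ, ‖η‖ ≤ c ∧ ∀ w ∈ K, 0 ≤ φ w + η (j w) := by
  let p : V → ℝ := fun v => ⨅ w : K, (c * ‖v + j w‖ + φ w)
  have : Nonempty K := ⟨⟨0, h0⟩⟩
  have bdd : ∀ v, BddBelow (Set.range fun w : K => c * ‖v + j w‖ + φ w) := by
    intro v
    refine ⟨-(c * ‖v‖), ?_⟩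
    rintro _ ⟨w, rfl⟩
    have h1 := hbound w w.2
    have h2 : ‖j w‖ ≤ ‖v + j w‖ + ‖v‖ := by
      simpa using norm_sub_le (v + j w) v
    have h3 := mul_le_mul_of_nonneg_left h2 hc
    dsimp only
    linarith
  have p_le : ∀ v, ∀ w ∈ K, p v ≤ c * ‖v + j w‖ + φ w := fun v w hw =>
    ciInf_le (bdd v) ⟨w, hw⟩
  have p_smul_le : ∀ t : ℝ, 0 < t → ∀ v, p (t • v) ≤ t * p v := by
    intro t ht v
    simp only [p]
    rw [Real.mul_iInf_of_nonneg ht.le]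
    refine le_ciInf fun w => ?_
    obtain ⟨hw, hφ⟩ := hsmul t ht w w.2
    refine (p_le (t • v) _ hw).trans (le_of_eq ?_)
    rw [hφ, map_smul, ← smul_add, norm_smul, Real.norm_of_nonneg ht.le]
    ring
  have p_smul : ∀ t : ℝ, 0 < t → ∀ v, p (t • v) = t * p v := by
    intro t ht v
    refine le_antisymm (p_smul_le t ht v) ?_
    have h := mul_le_mul_of_nonneg_left (p_smul_le t⁻¹ (inv_pos.2 ht) (t • v)) ht.le
    rwa [inv_smul_smul₀ ht.ne', mul_inv_cancel_left₀ ht.ne'] at h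
  have p_add : ∀ x y, p (x + y) ≤ p x + p y := by
    intro x y
    refine le_ciInf_add_ciInf fun w w' => ?_
    obtain ⟨hw, hφ⟩ := hadd w w.2 w' w'.2
    have h1 := p_le (x + y) _ hw
    have h2 : ‖x + y + j (w + w')‖ ≤ ‖x + j w‖ + ‖y + j w'‖ := by
      rw [map_add, add_add_add_comm]
      exact norm_add_le _ _
    have h3 := mul_le_mul_of_nonneg_left h2 hc
    linarith
  have p_norm : ∀ v, p v ≤ c * ‖v‖ := fun v => by simpa [hφ0] using p_le v 0 h0
  have p_zero : 0 ≤ p 0 := le_ciInf fun w => by simpa [add_comm] using hbound w w.2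
  obtain ⟨g, -, hg⟩ := exists_extension_of_le_sublinear (⊥ : V →ₗ.[ℝ] ℝ) p p_smul p_add (by
    rintro ⟨x, hx⟩
    obtain rfl : x = 0 := (Submodule.mem_bot ℝ).1 hx
    have h : (⊥ : V →ₗ.[ℝ] ℝ) ⟨0, hx⟩ = 0 := LinearPMap.map_zero _
    rw [h]
    exact p_zero)
  have hgn : ∀ v, ‖g v‖ ≤ c * ‖v‖ := fun v => by
    have h1 := (hg v).trans (p_norm v)
    have h2 := (hg (-v)).trans (p_norm (-v))
    rw [map_neg, norm_neg] at h2
    exact abs_le.2 ⟨by linarith, h1⟩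
  refine ⟨g.mkContinuous c hgn, g.mkContinuous_norm_le hc hgn, fun w hw => ?_⟩
  have h := (hg (-j w)).trans (p_le (-j w) w hw)
  simp only [map_neg, neg_add_cancel, norm_zero, mul_zero, zero_add] at h
  change 0 ≤ φ w + g (j w)
  linarith

theorem PosOneHom.add_le {Z : Type*} [NormedAddCommGroup Z] [NormedSpace ℝ Z] {R : Z → ℝ≥0∞}
    (hhom : PosOneHom R) (hconv : ConvexOnENN R) (x y : Z) : R (x + y) ≤ R x + R y := by
  have h := hconv ((2 : ℝ) • x) ((2 : ℝ) • y) (1 / 2) (1 / 2) (by norm_num) (by norm_num)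
    (by norm_num)
  rw [smul_smul, smul_smul, hhom.2 2 two_pos, hhom.2 2 two_pos, ← mul_assoc, ← mul_assoc,
    ← ENNReal.ofReal_mul (by norm_num)] at h
  simpa using h

/-- First-order optimality: a minimizer of `G + R` over a set also minimizes the linearization
`DG + R` along feasible segments. -/
theorem linearized_le_of_segment_min {Z : Type*} [NormedAddCommGroup Z] [NormedSpace ℝ Z]
    {G : Z → ℝ} {ξ : Z →L[ℝ] ℝ} {z u : Z} (hG : HasFDerivAt G ξ z) {a : ℝ}
    (h : ∀ t : ℝ, 0 < t → t ≤ 1 → G z ≤ G (z + t • u) + t * a) : 0 ≤ ξ u + a := by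
  have hd : HasDerivAt (fun t : ℝ => G (z + t • u)) (ξ u) 0 := hG.hasLineDerivAt u
  have hle : -a ≤ ξ u := by
    refine ge_of_tendsto hd.tendsto_slope_zero_right ?_
    filter_upwards [Ioc_mem_nhdsGT (zero_lt_one' ℝ)] with t ht
    have h1 := h t ht.1 ht.2
    simp only [zero_add, zero_smul, add_zero, smul_eq_mul]
    rw [inv_mul_eq_div, le_div_iff₀ ht.1]
    linarith
  linarith

theorem mem_subdiff_zero_iff {Z : Type*} [NormedAddCommGroup Z] [NormedSpace ℝ Z] {R : Z → ℝ≥0∞}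
    (h0 : R 0 = 0) {ξ : Z →L[ℝ] ℝ} :
    ξ ∈ Subdiff R 0 ↔ ∀ w, R w ≠ ⊤ → ξ w ≤ (R w).toReal := by
  simp only [Subdiff, Set.mem_ofPred_eq, h0, sub_zero, EReal.coe_ennreal_zero, zero_add]
  refine forall_congr' fun w => ?_
  by_cases hw : R w = ⊤
  · simp [hw]
  · rw [← EReal.coe_ennreal_toReal hw, EReal.coe_le_coe_iff]
    simp [hw]

/-- **Optimality properties of the constrained incremental minimization step.**
Let `Z` be a real reflexive Banach space, `V` a real Banach space and `j : Z → V` a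
continuous dense embedding. Let `R : Z → [0,∞]` be proper, convex, lower semicontinuous
and positively 1-homogeneous, `G : Z → ℝ` convex and Fréchet differentiable with
derivative `DG`, `ρ > 0`, and let `z⋆` minimize `z ↦ G z + R (z - z₀)` over
`{z : ‖j (z - z₀)‖ ≤ ρ}`. Then there exists `η ∈ V*` such that, with
`b = ‖j (z⋆ - z₀)‖` and `d = dist_{V*}(-DG z⋆, ∂R(0))`:
(i) `‖η‖ (b - ρ) = 0`; (ii) `ρ d = ⟨η, j(z⋆ - z₀)⟩ = ρ ‖η‖ = ‖η‖ b`;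
(iii) `R(z⋆ - z₀) + ρ d = ⟨-DG z⋆, z⋆ - z₀⟩`; (iv) `R(z⋆ - z₀) + b d = ⟨-DG z⋆, z⋆ - z₀⟩`;
(v) `R v ≥ -⟨j*η + DG z⋆, v⟩` for all `v`; in particular `d < ∞`. -/
theorem statement0
    {Z V : Type*} [NormedAddCommGroup Z] [NormedSpace ℝ Z] [CompleteSpace Z]
    [NormedAddCommGroup V] [NormedSpace ℝ V] [CompleteSpace V]
    (hZrefl : Function.Surjective (NormedSpace.inclusionInDoubleDual ℝ Z))
    (j : Z →L[ℝ] V) (hjinj : Function.Injective j) (hjdense : DenseRange j)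
    (R : Z → ℝ≥0∞) (hRproper : ∃ z, R z ≠ ⊤) (hRconv : ConvexOnENN R)
    (hRlsc : LowerSemicontinuous R) (hRhom : PosOneHom R)
    (G : Z → ℝ) (DG : Z → (Z →L[ℝ] ℝ)) (hG : ∀ z, HasFDerivAt G (DG z) z)
    (hGconv : ConvexOn ℝ Set.univ G)
    (ρ : ℝ) (hρ : 0 < ρ) (z₀ zstar : Z)
    (hfeas : ‖j (zstar - z₀)‖ ≤ ρ)
    (hmin : ∀ z : Z, ‖j (z - z₀)‖ ≤ ρ →
      (G zstar : EReal) + (R (zstar - z₀) : EReal) ≤ (G z : EReal) + (R (z - z₀) : EReal)) :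
    ∃ η : V →L[ℝ] ℝ,
      ‖η‖ * (‖j (zstar - z₀)‖ - ρ) = 0 ∧
      ((ENNReal.ofReal ρ * DistVStar j (-(DG zstar)) (Subdiff R 0) : ℝ≥0∞) : EReal)
        = ((η (j (zstar - z₀)) : ℝ) : EReal) ∧
      ((ENNReal.ofReal ρ * DistVStar j (-(DG zstar)) (Subdiff R 0) : ℝ≥0∞) : EReal)
        = ((ρ * ‖η‖ : ℝ) : EReal) ∧
      ((ENNReal.ofReal ρ * DistVStar j (-(DG zstar)) (Subdiff R 0) : ℝ≥0∞) : EReal)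
        = ((‖η‖ * ‖j (zstar - z₀)‖ : ℝ) : EReal) ∧
      (R (zstar - z₀) : EReal)
          + ((ENNReal.ofReal ρ * DistVStar j (-(DG zstar)) (Subdiff R 0) : ℝ≥0∞) : EReal)
        = (((-(DG zstar)) (zstar - z₀) : ℝ) : EReal) ∧
      (R (zstar - z₀) : EReal)
          + ((ENNReal.ofReal ‖j (zstar - z₀)‖ * DistVStar j (-(DG zstar)) (Subdiff R 0) :
              ℝ≥0∞) : EReal)
        = (((-(DG zstar)) (zstar - z₀) : ℝ) : EReal) ∧
      (∀ v : Z, ((-((η.comp j + DG zstar) v) : ℝ) : EReal) ≤ (R v : EReal)) ∧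
      DistVStar j (-(DG zstar)) (Subdiff R 0) < ⊤ := by
  set v := zstar - z₀ with hv
  set ξ := DG zstar with hξ
  have hr : R v ≠ ⊤ := by
    intro htop
    have h := hmin z₀ (by simpa using hρ.le)
    rw [htop, sub_self, hRhom.1, EReal.coe_ennreal_top, EReal.coe_add_top] at h
    simp at h
  let φ : Z → ℝ := fun w => (R w).toReal + ξ w
  have hφmin : ∀ w, R w ≠ ⊤ → ‖j w‖ ≤ ρ → φ v ≤ φ w := by
    intro w hw hjw
    have key : 0 ≤ ξ (w - v) + ((R w).toReal - (R v).toReal) := by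
      refine linearized_le_of_segment_min (hG zstar) fun t ht ht1 => ?_
      have hz : zstar + t • (w - v) - z₀ = (1 - t) • v + t • w := by
        rw [hv]; module
      have hfeas' : ‖j (zstar + t • (w - v) - z₀)‖ ≤ ρ := by
        rw [hz, map_add, map_smul, map_smul]
        refine (norm_add_le _ _).trans ?_
        rw [norm_smul, norm_smul, Real.norm_of_nonneg ht.le,
          Real.norm_of_nonneg (sub_nonneg.2 ht1)]
        nlinarith [mul_le_mul_of_nonneg_left hfeas (sub_nonneg.2 ht1),
          mul_le_mul_of_nonneg_left hjw ht.le]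
      have h1 := hmin _ hfeas'
      rw [hz] at h1
      have h2 := hRconv v w (1 - t) t (sub_nonneg.2 ht1) ht.le (by ring)
      have htop : ENNReal.ofReal (1 - t) * R v + ENNReal.ofReal t * R w ≠ ⊤ :=
        ENNReal.add_ne_top.2 ⟨ENNReal.mul_ne_top ENNReal.ofReal_ne_top hr,
          ENNReal.mul_ne_top ENNReal.ofReal_ne_top hw⟩
      have h3 := ENNReal.toReal_mono htop h2
      rw [ENNReal.toReal_add (ENNReal.mul_ne_top ENNReal.ofReal_ne_top hr)
        (ENNReal.mul_ne_top ENNReal.ofReal_ne_top hw), ENNReal.toReal_mul, ENNReal.toReal_mul,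
        ENNReal.toReal_ofReal (sub_nonneg.2 ht1), ENNReal.toReal_ofReal ht.le] at h3
      rw [← EReal.coe_ennreal_toReal hr, ← EReal.coe_ennreal_toReal (ne_top_of_le_ne_top htop h2),
        ← EReal.coe_add, ← EReal.coe_add, EReal.coe_le_coe_iff] at h1
      linarith
    rw [map_sub] at key
    simp only [φ]
    linarith
  have hφ0 : φ 0 = 0 := by simp [φ, hRhom.1]
  have hφv : φ v ≤ 0 := hφ0 ▸ hφmin 0 (by simp [hRhom.1]) (by simpa using hρ.le)
  have hsmul : ∀ t : ℝ, 0 < t → ∀ x, R x ≠ ⊤ → R (t • x) ≠ ⊤ ∧ φ (t • x) = t * φ x := by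
    intro t ht x hx
    simp only [φ]
    rw [hRhom.2 t ht, ENNReal.toReal_mul, ENNReal.toReal_ofReal ht.le, map_smul, smul_eq_mul]
    exact ⟨ENNReal.mul_ne_top ENNReal.ofReal_ne_top hx, by ring⟩
  obtain ⟨c, hc⟩ : ∃ c : ℝ, ρ * c = -φ v := ⟨-φ v / ρ, mul_div_cancel₀ _ hρ.ne'⟩
  have hc0 : 0 ≤ c := nonneg_of_mul_nonneg_right (by linarith) hρ
  obtain ⟨η, hηc, hη⟩ := exists_dual_le_of_sublinear j {w | R w ≠ ⊤} φ c hc0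
    (by simp [hRhom.1]) hφ0
    (fun x hx y hy => by
      have hle := hRhom.add_le hRconv x y
      have htop := ENNReal.add_ne_top.2 ⟨hx, hy⟩
      refine ⟨ne_top_of_le_ne_top htop hle, ?_⟩
      have h := ENNReal.toReal_mono htop hle
      rw [ENNReal.toReal_add hx hy] at h
      simp only [φ, map_add]
      linarith)
    hsmul
    (fun w hw => by
      rcases (norm_nonneg (j w)).eq_or_lt with h | h
      · obtain rfl : w = 0 := hjinj (by rw [map_zero]; exact norm_eq_zero.1 h.symm)
        simp [hφ0]
      · have ht := div_pos hρ h
        obtain ⟨h1, h2⟩ := hsmul _ ht w hw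
        have h3 := hφmin _ h1 (by
          rw [map_smul, norm_smul, Real.norm_of_nonneg ht.le, div_mul_cancel₀ _ h.ne'])
        rw [h2, div_mul_eq_mul_div, le_div_iff₀ h] at h3
        have h4 : 0 ≤ ρ * (φ w + c * ‖j w‖) := by
          linear_combination h3 - ‖j w‖ * hc
        exact nonneg_of_mul_nonneg_right h4 hρ)
  have hb0 := norm_nonneg (j v)
  have hηv := hη v hr
  have hle : η (j v) ≤ ‖η‖ * ‖j v‖ := (le_abs_self _).trans (η.le_opNorm _)
  have hle1 : ‖η‖ * ‖j v‖ ≤ c * ‖j v‖ := mul_le_mul_of_nonneg_right hηc hb0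
  have hle2 : c * ‖j v‖ ≤ c * ρ := mul_le_mul_of_nonneg_left hfeas hc0
  have hηnorm : ‖η‖ = c := by
    refine le_antisymm hηc (le_of_mul_le_mul_right ?_ hρ)
    have := mul_le_mul_of_nonneg_left hfeas (norm_nonneg η)
    linarith
  have hcb : c * ‖j v‖ = ρ * c := by rw [hηnorm] at hle; linarith
  have hηjv : η (j v) = ρ * c := by rw [hηnorm] at hle; linarith
  have hmem : ∀ η' : V →L[ℝ] ℝ, -ξ - η'.comp j ∈ Subdiff R 0 ↔
      ∀ w, R w ≠ ⊤ → 0 ≤ φ w + η' (j w) := by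
    intro η'
    rw [mem_subdiff_zero_iff hRhom.1]
    refine forall₂_congr fun w _ => ?_
    simp only [φ, sub_apply, neg_apply,
      ContinuousLinearMap.comp_apply]
    constructor <;> intro h <;> linarith
  have hd : DistVStar j (-ξ) (Subdiff R 0) = ENNReal.ofReal c := by
    refine le_antisymm ?_ (le_iInf₂ fun η' hη' => ?_)
    · refine (iInf₂_le η ((hmem η).2 hη)).trans (le_of_eq ?_)
      rw [← hηnorm, ofReal_norm]
      rfl
    · have h1 := (hmem η').1 hη' v hr
      have h2 : η' (j v) ≤ ‖η'‖ * ‖j v‖ := (le_abs_self _).trans (η'.le_opNorm _)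
      have h3 := mul_le_mul_of_nonneg_left hfeas (norm_nonneg η')
      have h4 : c ≤ ‖η'‖ := le_of_mul_le_mul_right (by linarith) hρ
      refine (ENNReal.ofReal_le_ofReal h4).trans (le_of_eq ?_)
      rw [ofReal_norm]
      rfl
  have hcoe : ∀ s : ℝ, 0 ≤ s → ((ENNReal.ofReal s * ENNReal.ofReal c : ℝ≥0∞) : EReal)
      = ((s * c : ℝ) : EReal) := by
    intro s hs
    rw [← ENNReal.ofReal_mul hs, EReal.coe_ennreal_ofReal, max_eq_left (mul_nonneg hs hc0)]
  have hsum : (R v).toReal + ρ * c = (-ξ) v := by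
    simp only [φ] at hc
    rw [neg_apply]
    linarith
  refine ⟨η, ?_⟩
  rw [hηnorm, hηjv, hd, hcoe ρ hρ.le, hcoe _ hb0, mul_comm ‖j v‖ c, hcb,
    ← EReal.coe_ennreal_toReal hr, ← EReal.coe_add, hsum]
  refine ⟨by linarith, rfl, rfl, rfl, rfl, rfl, fun w => ?_, ENNReal.ofReal_lt_top⟩
  have h := (hmem η).2 hη w
  rw [hRhom.1, sub_zero, EReal.coe_ennreal_zero, zero_add] at h
  have hneg : -((η.comp j + ξ) w) = (-ξ - η.comp j) w := by
    simp only [add_apply, sub_apply,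
      neg_apply]
    ring
  rwa [hneg]
end
end

section
/- Let Z and V be real Banach spaces with a continuous dense embedding j : Z → V, let ρ > 0 and v ∈ Z, and let χ̃_ρ : V → [0,∞] denote the indicator function of the closed ball {w ∈ V : ‖w‖_V ≤ ρ}. Then the subdifferentials of χ_ρ on Z and of χ̃_ρ on V coincide in the following sense: (i) every ξ ∈ ∂χ_ρ(v) ⊆ Z* is of the form ξ = j*η for a unique η ∈ V*, and this η lies in ∂χ̃_ρ(j v) = {η ∈ V* : ⟨η, w − j v⟩ ≤ 0 for all w ∈ V with ‖w‖_V ≤ ρ} (assuming ‖j v‖_V ≤ ρ); (ii) conversely, for every η ∈ ∂χ̃_ρ(j v) one has j*η ∈ ∂χ_ρ(v). -/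
open Filter
open scoped ENNReal

noncomputable section

/-- The indicator function `χ_ρ` of the set `{v ∈ Z : ‖j v‖_V ≤ ρ}`. -/
def chiRho {Z V : Type*} [NormedAddCommGroup Z] [NormedSpace ℝ Z]
    [NormedAddCommGroup V] [NormedSpace ℝ V] (j : Z →L[ℝ] V) (ρ : ℝ) (v : Z) : ℝ≥0∞ :=
  if ‖j v‖ ≤ ρ then 0 else ⊤

/-- On the ball `‖j v‖ ≤ ρ`, the subgradients of `χ_ρ` are the functionals attaining their maximum
over the ball at `v`. -/
theorem mem_subdiff_chiRho_iff {Z V : Type*} [NormedAddCommGroup Z] [NormedSpace ℝ Z]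
    [NormedAddCommGroup V] [NormedSpace ℝ V] {j : Z →L[ℝ] V} {ρ : ℝ} {v : Z}
    (hv : ‖j v‖ ≤ ρ) {ξ : Z →L[ℝ] ℝ} :
    ξ ∈ Subdiff (chiRho j ρ) v ↔ ∀ w : Z, ‖j w‖ ≤ ρ → ξ w ≤ ξ v := by
  refine forall_congr' fun w => ?_
  by_cases hw : ‖j w‖ ≤ ρ
  · simp only [chiRho, hv, hw, if_true, EReal.coe_ennreal_zero, zero_add, map_sub, true_imp_iff]
    rw [EReal.coe_nonpos, sub_nonpos]
  · simp [chiRho, hw]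

/-- A functional bounded above by `M` on the ball `‖j w‖ ≤ ρ` is bounded by `M / ρ` with respect to
the norm `‖j ·‖`. -/
theorem norm_apply_le_of_le_on_ball {Z V : Type*} [NormedAddCommGroup Z] [NormedSpace ℝ Z]
    [NormedAddCommGroup V] [NormedSpace ℝ V] {j : Z →L[ℝ] V} (hj : Function.Injective j)
    {ρ : ℝ} (hρ : 0 < ρ) {ξ : Z →L[ℝ] ℝ} {M : ℝ} (h : ∀ w : Z, ‖j w‖ ≤ ρ → ξ w ≤ M) (w : Z) :
    ‖ξ w‖ ≤ M / ρ * ‖j w‖ := by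
  have key : ∀ z : Z, ξ z ≤ M / ρ * ‖j z‖ := by
    intro z
    rcases eq_or_ne z 0 with rfl | hz
    · simp
    have hpos : 0 < ‖j z‖ := norm_pos_iff.2 ((map_ne_zero_iff j hj).2 hz)
    have hscale := h ((ρ / ‖j z‖) • z) (by
      rw [map_smul, norm_smul, Real.norm_of_nonneg (by positivity),
        div_mul_cancel₀ _ hpos.ne'])
    rw [map_smul, smul_eq_mul, div_mul_eq_mul_div, div_le_iff₀ hpos] at hscale
    rw [div_mul_eq_mul_div, le_div_iff₀ hρ]
    linarith
  have hneg := key (-w)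
  rw [map_neg, map_neg, norm_neg] at hneg
  exact abs_le.2 ⟨by linarith, key w⟩

/-- **Coincidence of the subdifferentials of `χ_ρ` on `Z` and of `χ̃_ρ` on `V`.**
Let `Z`, `V` be real Banach spaces with a continuous dense embedding `j : Z → V`,
`ρ > 0` and `v ∈ Z` with `‖j v‖_V ≤ ρ`. Then:
(i) every `ξ ∈ ∂χ_ρ(v) ⊆ Z*` has the form `ξ = j*η` for a unique `η ∈ V*`, and this `η`
lies in `∂χ̃_ρ(j v) = {η ∈ V* : ⟨η, w - j v⟩ ≤ 0 for all w ∈ V with ‖w‖ ≤ ρ}`;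
(ii) conversely, for every `η ∈ ∂χ̃_ρ(j v)` one has `j*η ∈ ∂χ_ρ(v)`. -/
theorem statement3
    {Z V : Type*} [NormedAddCommGroup Z] [NormedSpace ℝ Z] [CompleteSpace Z]
    [NormedAddCommGroup V] [NormedSpace ℝ V] [CompleteSpace V]
    (j : Z →L[ℝ] V) (hjinj : Function.Injective j) (hjdense : DenseRange j)
    (ρ : ℝ) (hρ : 0 < ρ) (v : Z) (hv : ‖j v‖ ≤ ρ) :
    (∀ ξ ∈ Subdiff (chiRho j ρ) v,
      ∃! η : V →L[ℝ] ℝ, ξ = η.comp j ∧ ∀ w : V, ‖w‖ ≤ ρ → η (w - j v) ≤ 0) ∧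
    (∀ η : V →L[ℝ] ℝ, (∀ w : V, ‖w‖ ≤ ρ → η (w - j v) ≤ 0) →
      η.comp j ∈ Subdiff (chiRho j ρ) v) := by
  refine ⟨fun ξ hξ => ?_, fun η hη => ?_⟩
  · rw [mem_subdiff_chiRho_iff hv] at hξ
    have hbound := norm_apply_le_of_le_on_ball hjinj hρ hξ
    have hdense : DenseRange (j : Z →ₗ[ℝ] V) := hjdense
    obtain ⟨η, hηj, hη⟩ : ∃ η : V →L[ℝ] ℝ,
        (∀ x, η (j x) = ξ x) ∧ ∀ y, ‖η y‖ ≤ ξ v / ρ * ‖y‖ :=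
      ⟨(ξ : Z →ₗ[ℝ] ℝ).extendOfNorm (j : Z →ₗ[ℝ] V),
        LinearMap.extendOfNorm_eq hdense ⟨_, hbound⟩,
        LinearMap.norm_extendOfNorm_apply_le hdense _ hbound⟩
    refine ⟨η, ⟨ContinuousLinearMap.ext fun x => (hηj x).symm, fun w hw => ?_⟩, ?_⟩
    · have hM : 0 ≤ ξ v := by simpa using hξ 0 (by simpa using hρ.le)
      rw [map_sub, hηj, sub_nonpos]
      calc η w ≤ ‖η w‖ := Real.le_norm_self _
        _ ≤ ξ v / ρ * ‖w‖ := hη w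
        _ ≤ ξ v / ρ * ρ := by gcongr
        _ = ξ v := div_mul_cancel₀ _ hρ.ne'
    · rintro η' ⟨h', -⟩
      refine ContinuousLinearMap.coeFn_injective
        (hjdense.equalizer η'.continuous η.continuous (funext fun x => ?_))
      simp [hηj, h']
  · rw [mem_subdiff_chiRho_iff hv]
    intro w hw
    simpa using hη (j w) hw
end
end

section
/- Let Z and V be real Banach spaces with a continuous dense embedding j : Z → V, where V is reflexive, and let R : Z → [0,∞] be a proper, positively 1-homogeneous, convex and continuous function. Then for every ζ ∈ Z* with dist_{V*}(ζ, ∂R(0)) < ∞ the distance is attained: there exist σ ∈ ∂R(0) and η ∈ V* with ζ − σ = j*η and ‖η‖_{V*} = dist_{V*}(ζ, ∂R(0)). -/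
open Filter
open scoped ENNReal

noncomputable section

/-- A nonempty weak-* closed subset of the dual of a normed space has an element of minimal
norm. -/
theorem exists_isMinOn_nnnorm_of_isClosed_weakDual {V : Type*} [NormedAddCommGroup V]
    [NormedSpace ℝ V] {S : Set (V →L[ℝ] ℝ)}
    (hS : IsClosed (WeakDual.toStrongDual ⁻¹' S : Set (WeakDual ℝ V))) (hne : S.Nonempty) :
    ∃ η ∈ S, IsMinOn (fun θ : V →L[ℝ] ℝ => ‖θ‖₊) S η := by
  obtain ⟨θ, hθ⟩ := hne
  have hlsc : LowerSemicontinuous fun η : WeakDual ℝ V => ‖WeakDual.toStrongDual η‖ := by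
    refine lowerSemicontinuous_iff_isClosed_preimage.2 fun r => ?_
    convert WeakDual.isClosed_closedBall (𝕜 := ℝ) (0 : V →L[ℝ] ℝ) r using 1
    ext η
    simp
  have hcpt : IsCompact ((WeakDual.toStrongDual ⁻¹' Metric.closedBall (0 : V →L[ℝ] ℝ) ‖θ‖ ∩
      WeakDual.toStrongDual ⁻¹' S : Set (WeakDual ℝ V))) :=
    (WeakDual.isCompact_closedBall (𝕜 := ℝ) (0 : V →L[ℝ] ℝ) ‖θ‖).inter_right hS
  obtain ⟨η, ⟨hηθ, hηS⟩, hmin⟩ := (hlsc.lowerSemicontinuousOn _).exists_isMinOn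
    (s := WeakDual.toStrongDual ⁻¹' Metric.closedBall (0 : V →L[ℝ] ℝ) ‖θ‖ ∩
      WeakDual.toStrongDual ⁻¹' S)
    ⟨StrongDual.toWeakDual θ, by simp, by simpa using hθ⟩ hcpt
  refine ⟨WeakDual.toStrongDual η, hηS, fun φ hφ => ?_⟩
  rcases le_total ‖φ‖ ‖θ‖ with h | h
  · exact hmin (a := StrongDual.toWeakDual φ) ⟨by simpa using h, by simpa using hφ⟩
  · exact (mem_closedBall_zero_iff.1 hηθ).trans h

/-- Functionals `η` with `ζ - η ∘ j` in a given subdifferential form a weak-* closed set. -/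
theorem isClosed_setOf_sub_comp_mem_subdiff {Z V : Type*} [NormedAddCommGroup Z]
    [NormedSpace ℝ Z] [NormedAddCommGroup V] [NormedSpace ℝ V] (j : Z →L[ℝ] V)
    (ζ : Z →L[ℝ] ℝ) (f : Z → ℝ≥0∞) (v : Z) :
    IsClosed (WeakDual.toStrongDual ⁻¹' {η : V →L[ℝ] ℝ | ζ - η.comp j ∈ Subdiff f v} :
      Set (WeakDual ℝ V)) := by
  have heval (w : Z) : Continuous fun η : WeakDual ℝ V => ζ (w - v) - η (j (w - v)) :=
    continuous_const.sub (WeakDual.eval_continuous _)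
  have hclosed (w : Z) : IsClosed {t : ℝ | (f v : EReal) + (t : EReal) ≤ (f w : EReal)} := by
    have : Continuous fun t : ℝ => (f v : EReal) + (t : EReal) := by
      refine continuous_iff_continuousAt.2 fun t => ?_
      have hadd : ContinuousAt (fun p : EReal × EReal => p.1 + p.2)
          ((f v : EReal), (t : EReal)) := EReal.continuousAt_add (by simp) (by simp)
      exact hadd.comp (f := fun t : ℝ => ((f v : EReal), (t : EReal)))
        (continuousAt_const.prodMk continuous_coe_real_ereal.continuousAt)
    exact isClosed_le this continuous_const
  convert isClosed_iInter fun w => (hclosed w).preimage (heval w) using 1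
  ext η
  rw [Set.mem_iInter]
  exact Iff.rfl

/-- **Attainment of the finite `V*`-distance.**
Let `Z`, `V` be real Banach spaces with a continuous dense embedding `j : Z → V`, where
`V` is reflexive, and let `R : Z → [0,∞]` be proper, positively 1-homogeneous, convex and
continuous. Then for every `ζ ∈ Z*` with `dist_{V*}(ζ, ∂R(0)) < ∞` the distance is
attained: there are `σ ∈ ∂R(0)` and `η ∈ V*` with `ζ - σ = j*η` and
`‖η‖_{V*} = dist_{V*}(ζ, ∂R(0))`. -/
theorem statement7
    {Z V : Type*} [NormedAddCommGroup Z] [NormedSpace ℝ Z] [CompleteSpace Z]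
    [NormedAddCommGroup V] [NormedSpace ℝ V] [CompleteSpace V]
    (j : Z →L[ℝ] V) (hjinj : Function.Injective j) (hjdense : DenseRange j)
    (hVrefl : Function.Surjective (NormedSpace.inclusionInDoubleDual ℝ V))
    (R : Z → ℝ≥0∞) (hRproper : ∃ z, R z ≠ ⊤) (hRhom : PosOneHom R)
    (hRconv : ConvexOnENN R) (hRcont : Continuous R) :
    ∀ ζ : Z →L[ℝ] ℝ, DistVStar j ζ (Subdiff R 0) ≠ ⊤ →
      ∃ σ ∈ Subdiff R 0, ∃ η : V →L[ℝ] ℝ,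
        ζ - σ = η.comp j ∧ (‖η‖₊ : ℝ≥0∞) = DistVStar j ζ (Subdiff R 0) := by
  intro ζ hζ
  have hne : {η : V →L[ℝ] ℝ | ζ - η.comp j ∈ Subdiff R 0}.Nonempty := by
    rw [Set.nonempty_iff_ne_empty]
    intro hS
    exact hζ (by simp [DistVStar, hS])
  obtain ⟨η, hη, hmin⟩ := exists_isMinOn_nnnorm_of_isClosed_weakDual
    (isClosed_setOf_sub_comp_mem_subdiff j ζ R 0) hne
  refine ⟨ζ - η.comp j, hη, η, sub_sub_cancel _ _, le_antisymm ?_ (iInf₂_le η hη)⟩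
  exact le_iInf₂ fun θ hθ => ENNReal.coe_le_coe.2 (hmin hθ)
end
end

section
/- Let S > 0 and, for each n ∈ ℕ, let δ_n, δ, τ_n, τ : (0,S) → [0,∞) be Lebesgue-measurable functions such that liminf_{n→∞} δ_n(s) ≥ δ(s) for almost every s ∈ (0,S), the functions τ_n and τ are integrable, and τ_n → τ weakly in L¹((0,S)), i.e. ∫₀^S τ_n(s) g(s) ds → ∫₀^S τ(s) g(s) ds for every g ∈ L^∞((0,S)). Then liminf_{n→∞} ∫₀^S τ_n(s) δ_n(s) ds ≥ ∫₀^S τ(s) δ(s) ds, where both integrals are understood as values in [0,∞]. -/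
open Filter MeasureTheory
open scoped ENNReal

noncomputable section

/-- The Lebesgue measure restricted to the interval `(0, S)`. -/
def muS (S : ℝ) : Measure ℝ := volume.restrict (Set.Ioo (0 : ℝ) S)

/-- For bounded measurable `h`, the hypothesis of weak convergence against `h.toReal` yields
convergence of the corresponding lower Lebesgue integrals. -/
theorem tendsto_lintegral_ofReal_mul_of_tendsto_integral {α : Type*} [MeasurableSpace α]
    {μ : Measure α} {τ : ℕ → α → ℝ} {τ' : α → ℝ} {h : α → ℝ≥0∞} {M : ℝ}
    (hh : Measurable h) (hM : ∀ s, h s ≤ ENNReal.ofReal M)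
    (hτ : ∀ n, Integrable (τ n) μ) (hτ' : Integrable τ' μ)
    (hτ0 : ∀ n, 0 ≤ᵐ[μ] τ n) (hτ'0 : 0 ≤ᵐ[μ] τ')
    (hlim : Tendsto (fun n => ∫ s, τ n s * (h s).toReal ∂μ) atTop
      (nhds (∫ s, τ' s * (h s).toReal ∂μ))) :
    Tendsto (fun n => ∫⁻ s, ENNReal.ofReal (τ n s) * h s ∂μ) atTop
      (nhds (∫⁻ s, ENNReal.ofReal (τ' s) * h s ∂μ)) := by
  have key : ∀ f : α → ℝ, Integrable f μ → 0 ≤ᵐ[μ] f →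
      ∫⁻ s, ENNReal.ofReal (f s) * h s ∂μ
        = ENNReal.ofReal (∫ s, f s * (h s).toReal ∂μ) := by
    intro f hf hf0
    have hint : Integrable (fun s => f s * (h s).toReal) μ := by
      refine hf.mul_bdd (c := (ENNReal.ofReal M).toReal)
        hh.ennreal_toReal.aestronglyMeasurable (ae_of_all _ fun s => ?_)
      rw [Real.norm_of_nonneg ENNReal.toReal_nonneg]
      exact ENNReal.toReal_mono ENNReal.ofReal_ne_top (hM s)
    rw [ofReal_integral_eq_lintegral_ofReal hint]
    · refine lintegral_congr_ae ?_
      filter_upwards [hf0] with s hs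
      rw [ENNReal.ofReal_mul hs,
        ENNReal.ofReal_toReal (ne_top_of_le_ne_top ENNReal.ofReal_ne_top (hM s))]
    · filter_upwards [hf0] with s hs
      exact mul_nonneg hs ENNReal.toReal_nonneg
  rw [key _ hτ' hτ'0]
  simp_rw [fun n => key _ (hτ n) (hτ0 n)]
  exact ENNReal.tendsto_ofReal hlim

/-- **Lower semicontinuity of mixed products (Lemma B.2 type result).**
Let `S > 0` and, for each `n`, let `δ_n, δ, τ_n, τ : (0,S) → [0,∞)` be measurable with
`liminf_n δ_n(s) ≥ δ(s)` a.e., `τ_n, τ` integrable, and `τ_n → τ` weakly in `L¹((0,S))`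
(i.e. `∫ τ_n g → ∫ τ g` for every `g ∈ L^∞((0,S))`). Then
`liminf_n ∫₀^S τ_n δ_n ds ≥ ∫₀^S τ δ ds`, both integrals being values in `[0,∞]`. -/
theorem statement9 (S : ℝ) (hS : 0 < S)
    (δ τ : ℕ → ℝ → ℝ) (δ' τ' : ℝ → ℝ)
    (hδmeas : ∀ n, Measurable (δ n)) (hδ'meas : Measurable δ')
    (hτmeas : ∀ n, Measurable (τ n)) (hτ'meas : Measurable τ')
    (hδnonneg : ∀ n, ∀ s ∈ Set.Ioo (0 : ℝ) S, 0 ≤ δ n s)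
    (hδ'nonneg : ∀ s ∈ Set.Ioo (0 : ℝ) S, 0 ≤ δ' s)
    (hτnonneg : ∀ n, ∀ s ∈ Set.Ioo (0 : ℝ) S, 0 ≤ τ n s)
    (hτ'nonneg : ∀ s ∈ Set.Ioo (0 : ℝ) S, 0 ≤ τ' s)
    (hliminf : ∀ᵐ s ∂(muS S),
      ENNReal.ofReal (δ' s) ≤ Filter.liminf (fun n => ENNReal.ofReal (δ n s)) Filter.atTop)
    (hτint : ∀ n, Integrable (τ n) (muS S)) (hτ'int : Integrable τ' (muS S))
    (hweak : ∀ g : ℝ → ℝ, Measurable g → (∃ M : ℝ, ∀ᵐ s ∂(muS S), |g s| ≤ M) →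
      Tendsto (fun n => ∫ s, τ n s * g s ∂(muS S)) atTop
        (nhds (∫ s, τ' s * g s ∂(muS S)))) :
    ∫⁻ s, ENNReal.ofReal (τ' s * δ' s) ∂(muS S)
      ≤ Filter.liminf (fun n => ∫⁻ s, ENNReal.ofReal (τ n s * δ n s) ∂(muS S))
          Filter.atTop := by
  have hmem : ∀ᵐ s ∂(muS S), s ∈ Set.Ioo (0 : ℝ) S := ae_restrict_mem measurableSet_Ioo
  have hτ0 : ∀ n, 0 ≤ᵐ[muS S] τ n := fun n => hmem.mono (hτnonneg n)
  have hτ'0 : 0 ≤ᵐ[muS S] τ' := hmem.mono hτ'nonneg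
  let a : ℕ → ℝ → ℝ≥0∞ := fun k s => ⨅ i, ENNReal.ofReal (δ (i + k) s)
  let h : ℕ → ℝ → ℝ≥0∞ := fun k s => (k : ℝ≥0∞) ⊓ a k s
  have ha_mono : ∀ s, Monotone fun k => a k s := by
    intro s k l hkl
    refine le_iInf fun i => ?_
    refine (iInf_le _ (i + (l - k))).trans_eq ?_
    rw [show i + (l - k) + k = i + l by omega]
  have hcast_mono : Monotone fun k : ℕ => (k : ℝ≥0∞) := Nat.mono_cast
  have hh_meas : ∀ k, Measurable (h k) := fun k =>
    measurable_const.inf (.iInf fun i => (hδmeas (i + k)).ennreal_ofReal)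
  have hh_bdd : ∀ k s, h k s ≤ ENNReal.ofReal k := fun k s => by
    rw [ENNReal.ofReal_natCast]
    exact inf_le_left
  have hh_sup : ∀ s, ⨆ k, h k s = liminf (fun n => ENNReal.ofReal (δ n s)) atTop := by
    intro s
    rw [liminf_eq_iSup_iInf_of_nat', iSup_inf_of_monotone hcast_mono (ha_mono s),
      ENNReal.iSup_natCast, top_inf_eq]
  have hbound : ∀ k, ∫⁻ s, ENNReal.ofReal (τ' s) * h k s ∂(muS S)
      ≤ liminf (fun n => ∫⁻ s, ENNReal.ofReal (τ n s * δ n s) ∂(muS S)) atTop := by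
    intro k
    have hlim := tendsto_lintegral_ofReal_mul_of_tendsto_integral (hh_meas k) (hh_bdd k)
      hτint hτ'int hτ0 hτ'0 (hweak (fun s => (h k s).toReal) (hh_meas k).ennreal_toReal
        ⟨k, ae_of_all _ fun s => by
          rw [abs_of_nonneg ENNReal.toReal_nonneg]
          exact ENNReal.toReal_le_of_le_ofReal k.cast_nonneg (hh_bdd k s)⟩)
    rw [← hlim.liminf_eq]
    refine liminf_le_liminf ?_
    filter_upwards [eventually_ge_atTop k] with n hn
    refine lintegral_mono_ae ?_
    filter_upwards [hτ0 n] with s hs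
    rw [ENNReal.ofReal_mul hs]
    gcongr
    refine inf_le_right.trans ((iInf_le _ (n - k)).trans_eq ?_)
    rw [Nat.sub_add_cancel hn]
  calc ∫⁻ s, ENNReal.ofReal (τ' s * δ' s) ∂(muS S)
      ≤ ∫⁻ s, ⨆ k, ENNReal.ofReal (τ' s) * h k s ∂(muS S) := by
        refine lintegral_mono_ae ?_
        filter_upwards [hτ'0, hliminf] with s hs hδs
        rw [ENNReal.ofReal_mul hs, ← ENNReal.mul_iSup, hh_sup]
        gcongr
    _ = ⨆ k, ∫⁻ s, ENNReal.ofReal (τ' s) * h k s ∂(muS S) :=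
        lintegral_iSup (fun k => hτ'meas.ennreal_ofReal.mul (hh_meas k)) fun k l hkl s =>
          mul_le_mul_right (inf_le_inf (hcast_mono hkl) (ha_mono s hkl)) _
    _ ≤ _ := iSup_le hbound
end
end

section
/- Let S > 0 and let V be a separable reflexive real Banach space. Let v_n, v ∈ L^∞((0,S); V) (Bochner classes) with v_n ⇀* v, meaning that ∫₀^S ⟨f(s), v_n(s)⟩ ds → ∫₀^S ⟨f(s), v(s)⟩ ds for every f ∈ L¹((0,S); V*). Further let δ_n, δ ∈ L¹((0,S); [0,∞)) with liminf_{n→∞} δ_n(s) ≥ δ(s) for almost every s ∈ (0,S). Then liminf_{n→∞} ∫₀^S ‖v_n(s)‖_V · δ_n(s) ds ≥ ∫₀^S ‖v(s)‖_V · δ(s) ds. -/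
open Filter MeasureTheory
open scoped ENNReal

noncomputable section

/-- If `v n` converges weakly-* to the essentially bounded function `v'`, then for every integrable
weight `η ≥ 0` the functional `∫ ‖·‖ η` is sequentially lower semicontinuous along `v n`. -/
theorem lintegral_norm_mul_le_liminf_of_weakStar {α : Type*} [MeasurableSpace α] {μ : Measure α}
    {V : Type*} [NormedAddCommGroup V] [NormedSpace ℝ V]
    {v : ℕ → α → V} {v' : α → V}
    (hv'meas : AEStronglyMeasurable v' μ)
    (hv'bdd : ∃ M : ℝ, ∀ᵐ s ∂μ, ‖v' s‖ ≤ M)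
    (hweakstar : ∀ f : α → (V →L[ℝ] ℝ), Integrable f μ →
      Tendsto (fun n => ∫ s, f s (v n s) ∂μ) atTop (nhds (∫ s, f s (v' s) ∂μ)))
    {η : α → ℝ} (hη : Integrable η μ) (hη0 : ∀ s, 0 ≤ η s) :
    ∫⁻ s, ENNReal.ofReal (‖v' s‖ * η s) ∂μ
      ≤ liminf (fun n => ∫⁻ s, ENNReal.ofReal (‖v n s‖ * η s) ∂μ) atTop := by
  obtain ⟨M, hM⟩ := hv'bdd
  choose φ hφ1 hφ2 using fun x : V => exists_dual_vector'' ℝ x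
  have hφle (x y : V) : |φ x y| ≤ ‖y‖ := by
    simpa using (φ x).le_of_opNorm_le (hφ1 x) y
  let w : ℕ → SimpleFunc α V := hv'meas.stronglyMeasurable_mk.approx
  have hw : ∀ᵐ s ∂μ, Tendsto (fun j => w j s) atTop (nhds (v' s)) := by
    filter_upwards [hv'meas.ae_eq_mk] with s hs
    rw [hs]
    exact hv'meas.stronglyMeasurable_mk.tendsto_approx s
  let f : ℕ → α → (V →L[ℝ] ℝ) := fun j s => η s • φ (w j s)
  have hφmeas (j : ℕ) : AEStronglyMeasurable (fun s => φ (w j s)) μ :=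
    ((w j).map φ).stronglyMeasurable.aestronglyMeasurable
  have hfint (j : ℕ) : Integrable (f j) μ := by
    refine hη.mono (hη.aestronglyMeasurable.smul (hφmeas j)) (.of_forall fun s => ?_)
    rw [norm_smul]
    exact mul_le_of_le_one_right (norm_nonneg _) (hφ1 _)
  have hfle (j : ℕ) (s : α) (x : V) : ‖f j s x‖ ≤ ‖x‖ * η s := by
    simp only [f, smul_apply, smul_eq_mul, norm_mul, Real.norm_eq_abs,
      abs_of_nonneg (hη0 s)]
    rw [mul_comm]
    exact mul_le_mul_of_nonneg_right (hφle _ _) (hη0 s)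
  have hbound : Integrable (fun s => ‖v' s‖ * η s) μ :=
    hη.bdd_mul hv'meas.norm (by simpa using hM)
  have hstep (j : ℕ) : ENNReal.ofReal (∫ s, f j s (v' s) ∂μ)
      ≤ liminf (fun n => ∫⁻ s, ENNReal.ofReal (‖v n s‖ * η s) ∂μ) atTop := by
    rw [← (ENNReal.tendsto_ofReal (hweakstar (f j) (hfint j))).liminf_eq]
    refine liminf_le_liminf (.of_forall fun n => ?_)
    calc ENNReal.ofReal (∫ s, f j s (v n s) ∂μ)
        ≤ ‖∫ s, f j s (v n s) ∂μ‖ₑ := by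
          rw [← ofReal_norm]
          exact ENNReal.ofReal_le_ofReal (Real.le_norm_self _)
      _ ≤ ∫⁻ s, ‖f j s (v n s)‖ₑ ∂μ := enorm_integral_le_lintegral_enorm _
      _ ≤ ∫⁻ s, ENNReal.ofReal (‖v n s‖ * η s) ∂μ := by
          refine lintegral_mono fun s => ?_
          rw [← ofReal_norm]
          exact ENNReal.ofReal_le_ofReal (hfle j s _)
  have hlim : Tendsto (fun j => ∫ s, f j s (v' s) ∂μ) atTop (nhds (∫ s, ‖v' s‖ * η s ∂μ)) := by
    refine tendsto_integral_of_dominated_convergence _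
      (fun j => (ContinuousLinearMap.apply ℝ ℝ).aestronglyMeasurable_comp₂ hv'meas (hfint j).aestronglyMeasurable) hbound
      (fun j => .of_forall fun s => hfle j s _) ?_
    filter_upwards [hw] with s hs
    have hφlim : Tendsto (fun j => φ (w j s) (v' s)) atTop (nhds ‖v' s‖) := by
      have hdiff : Tendsto (fun j => φ (w j s) (v' s - w j s)) atTop (nhds 0) := by
        refine squeeze_zero_norm (fun j => hφle _ _) ?_
        simpa using (hs.const_sub (v' s)).norm
      simpa [hφ2] using hdiff.add hs.norm
    simpa [f, mul_comm] using hφlim.const_mul (η s)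
  rw [← ofReal_integral_eq_lintegral_ofReal hbound
    (.of_forall fun s => mul_nonneg (norm_nonneg _) (hη0 s))]
  exact le_of_tendsto' (ENNReal.tendsto_ofReal hlim) hstep

/-- **Lower semicontinuity of `∫ ‖v_n‖ δ_n` under weak* convergence (Lemma B.1 type result).**
Let `S > 0` and let `V` be a separable reflexive real Banach space. Let `v_n, v` be
(representatives of) elements of `L^∞((0,S); V)` with `v_n ⇀* v`, i.e.
`∫ ⟨f(s), v_n(s)⟩ ds → ∫ ⟨f(s), v(s)⟩ ds` for every `f ∈ L¹((0,S); V*)`. Let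
`δ_n, δ ∈ L¹((0,S); [0,∞))` with `liminf_n δ_n(s) ≥ δ(s)` a.e. Then
`liminf_n ∫₀^S ‖v_n(s)‖ δ_n(s) ds ≥ ∫₀^S ‖v(s)‖ δ(s) ds`. -/
theorem statement10 (S : ℝ) (hS : 0 < S)
    {V : Type*} [NormedAddCommGroup V] [NormedSpace ℝ V]
    [TopologicalSpace.SeparableSpace V]
    (hVrefl : Function.Surjective (NormedSpace.inclusionInDoubleDual ℝ V))
    (v : ℕ → ℝ → V) (v' : ℝ → V)
    (hvmeas : ∀ n, AEStronglyMeasurable (v n) (muS S))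
    (hv'meas : AEStronglyMeasurable v' (muS S))
    (hvbdd : ∀ n, ∃ M : ℝ, ∀ᵐ s ∂(muS S), ‖v n s‖ ≤ M)
    (hv'bdd : ∃ M : ℝ, ∀ᵐ s ∂(muS S), ‖v' s‖ ≤ M)
    (hweakstar : ∀ f : ℝ → (V →L[ℝ] ℝ), Integrable f (muS S) →
      Tendsto (fun n => ∫ s, f s (v n s) ∂(muS S)) atTop
        (nhds (∫ s, f s (v' s) ∂(muS S))))
    (δ : ℕ → ℝ → ℝ) (δ' : ℝ → ℝ)
    (hδmeas : ∀ n, Measurable (δ n)) (hδ'meas : Measurable δ')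
    (hδnonneg : ∀ n, ∀ᵐ s ∂(muS S), 0 ≤ δ n s) (hδ'nonneg : ∀ᵐ s ∂(muS S), 0 ≤ δ' s)
    (hδint : ∀ n, Integrable (δ n) (muS S)) (hδ'int : Integrable δ' (muS S))
    (hliminf : ∀ᵐ s ∂(muS S),
      ENNReal.ofReal (δ' s) ≤ Filter.liminf (fun n => ENNReal.ofReal (δ n s)) Filter.atTop) :
    ∫⁻ s, ENNReal.ofReal (‖v' s‖ * δ' s) ∂(muS S)
      ≤ Filter.liminf (fun n => ∫⁻ s, ENNReal.ofReal (‖v n s‖ * δ n s) ∂(muS S))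
          Filter.atTop := by
  let H : ℕ → ℝ → ℝ≥0∞ := fun k s =>
    ENNReal.ofReal (δ' s) ⊓ ⨅ n ≥ k, ENNReal.ofReal (δ n s)
  have hHmeas (k : ℕ) : Measurable (H k) :=
    hδ'meas.ennreal_ofReal.inf (.iInf fun n => .iInf fun _ => (hδmeas n).ennreal_ofReal)
  have hHmono : Monotone H := fun k l hkl s =>
    inf_le_inf_left _ (le_iInf₂ fun n hn => iInf₂_le n (hkl.trans hn))
  have hHtop (k : ℕ) (s : ℝ) : H k s ≠ ⊤ := ne_top_of_le_ne_top ENNReal.ofReal_ne_top inf_le_left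
  have hHsup : ∀ᵐ s ∂(muS S), ENNReal.ofReal (‖v' s‖ * δ' s) = ⨆ k, ‖v' s‖ₑ * H k s := by
    filter_upwards [hliminf] with s hs
    rw [← ENNReal.mul_iSup, ← inf_iSup_eq, ← liminf_eq_iSup_iInf_of_nat, inf_eq_left.2 hs,
      ENNReal.ofReal_mul (norm_nonneg _), ofReal_norm]
  rw [lintegral_congr_ae hHsup, lintegral_iSup' (f := fun k s => ‖v' s‖ₑ * H k s)
    (fun k => hv'meas.enorm.mul (hHmeas k).aemeasurable)
    (.of_forall fun s k l hkl => mul_le_mul_right (hHmono hkl s) _)]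
  refine iSup_le fun k => ?_
  have hHint : Integrable (fun s => (H k s).toReal) (muS S) := by
    refine integrable_toReal_of_lintegral_ne_top (hHmeas k).aemeasurable
      (ne_top_of_le_ne_top hδ'int.lintegral_lt_top.ne (lintegral_mono fun s => inf_le_left))
  have key := lintegral_norm_mul_le_liminf_of_weakStar hv'meas hv'bdd hweakstar hHint
    (fun s => ENNReal.toReal_nonneg)
  simp only [ENNReal.ofReal_mul (norm_nonneg _), ofReal_norm,
    ENNReal.ofReal_toReal (hHtop k _)] at key ⊢
  refine key.trans (liminf_le_liminf ?_)
  filter_upwards [eventually_ge_atTop k] with n hn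
  exact lintegral_mono fun s => mul_le_mul_right (inf_le_right.trans (iInf₂_le n hn)) _
end
end

section
/- Let (X,d) be a metric space and let (x_i)_{i∈ℕ} be a sequence in X such that (a) every subsequence of (x_i) has a convergent further subsequence, and (b) there exists L ≥ 0 such that d(x_{i+1}, a) ≤ L · d(x_i, a) for every i ∈ ℕ and every accumulation point a of the sequence (x_i). Then either the sequence (x_i) converges, or the set A of accumulation points of (x_i) contains no point that is isolated in A. (This is the abstract content of the paper's lemma on accumulation points of the alternate-minimization iterates, where hypothesis (b) comes from the Lipschitz dependence of the minimizers and the fact that every accumulation point is a fixpoint of the scheme.) -/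
open Filter

/-- If `p` holds infinitely often and fails infinitely often, then infinitely often it holds
at `n` and fails at `n + 1`. -/
theorem frequently_and_not_succ {p : ℕ → Prop} (hp : ∃ᶠ n in atTop, p n)
    (hnp : ∃ᶠ n in atTop, ¬ p n) : ∃ᶠ n in atTop, p n ∧ ¬ p (n + 1) := by
  intro h
  obtain ⟨N, hN⟩ := eventually_atTop.1 h
  obtain ⟨m, hm, hpm⟩ := frequently_atTop.1 hp N
  obtain ⟨k, hk, hpk⟩ := frequently_atTop.1 hnp m
  refine hpk (Nat.le_induction hpm (fun n hn ih => ?_) k hk)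
  by_contra hc
  exact hN n (hm.trans hn) ⟨ih, hc⟩

/-- **Accumulation points of the alternate-minimization iterates.**
Let `(X, d)` be a metric space and `(x_i)` a sequence such that (a) every subsequence
has a convergent further subsequence, and (b) there is `L ≥ 0` with
`d(x_{i+1}, a) ≤ L · d(x_i, a)` for every `i` and every accumulation point `a` of the
sequence. Then either the sequence converges, or the set of accumulation points of
`(x_i)` contains no point that is isolated in it. -/
theorem statement15 {X : Type*} [MetricSpace X] (x : ℕ → X)
    (ha : ∀ φ : ℕ → ℕ, StrictMono φ → ∃ ψ : ℕ → ℕ, StrictMono ψ ∧ ∃ a : X,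
      Tendsto (fun k => x (φ (ψ k))) atTop (nhds a))
    (L : ℝ) (hL : 0 ≤ L)
    (hb : ∀ i : ℕ, ∀ a : X,
      (∃ φ : ℕ → ℕ, StrictMono φ ∧ Tendsto (fun k => x (φ k)) atTop (nhds a)) →
      dist (x (i + 1)) a ≤ L * dist (x i) a) :
    (∃ l : X, Tendsto x atTop (nhds l)) ∨
      ∀ a : X, (∃ φ : ℕ → ℕ, StrictMono φ ∧ Tendsto (fun k => x (φ k)) atTop (nhds a)) →
        ¬ ∃ δ : ℝ, 0 < δ ∧ ∀ b : X,
          (∃ φ : ℕ → ℕ, StrictMono φ ∧ Tendsto (fun k => x (φ k)) atTop (nhds b)) →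
          b ≠ a → δ < dist a b := by
  refine or_iff_not_imp_left.2 fun hconv a hacc => ?_
  rintro ⟨δ, hδ, hiso⟩
  refine hconv ⟨a, ?_⟩
  by_contra hlim
  obtain ⟨ε, hε, hfar⟩ : ∃ ε > 0, ∃ᶠ n in atTop, ¬ dist (x n) a < ε := by
    simpa [Metric.tendsto_nhds, Filter.Frequently] using hlim
  have hL1 : 0 < L + 1 := by linarith
  set r := min ε δ
  have hr0 : 0 < r := lt_min hε hδ
  set s := r / (L + 1) with hs
  have hs0 : 0 < s := div_pos hr0 hL1
  have hsr : L * s + s = r := by rw [hs]; field_simp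
  have hLs : 0 ≤ L * s := by positivity
  have hnear : ∃ᶠ n in atTop, dist (x n) a < s := by
    obtain ⟨φ, hφ, hφa⟩ := hacc
    exact hφ.tendsto_atTop.frequently
      (hφa.eventually (Metric.ball_mem_nhds a hs0)).frequently
  have hfar' : ∃ᶠ n in atTop, ¬ dist (x n) a < s := hfar.mono fun n hn hlt =>
    hn (by linarith [min_le_left ε δ])
  have hann : ∃ᶠ n in atTop, s ≤ dist (x (n + 1)) a ∧ dist (x (n + 1)) a ≤ δ := by
    refine (frequently_and_not_succ hnear hfar').mono fun n hn => ⟨not_lt.1 hn.2, ?_⟩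
    have := mul_le_mul_of_nonneg_left hn.1.le hL
    linarith [hb n a hacc, min_le_right ε δ]
  obtain ⟨φ, hφ, hφann⟩ := extraction_of_frequently_atTop hann
  obtain ⟨ψ, hψ, b, hb'⟩ := ha (fun k => φ k + 1) fun i j hij => Nat.succ_lt_succ (hφ hij)
  have hdist := hb'.dist (tendsto_const_nhds (x := a))
  have hsb : s ≤ dist b a := ge_of_tendsto' hdist fun k => (hφann (ψ k)).1
  have hbδ : dist b a ≤ δ := le_of_tendsto' hdist fun k => (hφann (ψ k)).2
  have hlt := hiso b ⟨fun k => φ (ψ k) + 1,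
    fun i j hij => Nat.succ_lt_succ (hφ (hψ hij)), hb'⟩ (dist_pos.1 (hs0.trans_le hsb))
  rw [dist_comm] at hlt
  exact hlt.not_ge hbδ
end
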